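/- Let T_d be the d-regular tree (d ≥ 2) and x any vertex. Then K_{T_d,x}(N) = 2 - 2d/N for 0 < N ≤ 2, and K_{T_d,x}(N) = 2 - d for N > 2. -/

import Mathlib

open Finset Filter Topology ENNReal SimpleGraph

noncomputable instance (priority := low) finLocFin {V : Type*} [Finite V] (G : SimpleGraph V) :
    G.LocallyFinite := fun _ => Fintype.ofFinite _

/-- Non-normalized graph Laplacian. -/
noncomputable def lap {V : Type*} (G : SimpleGraph V) [G.LocallyFinite] (f : V → ℝ) (x : V) : ℝ :=
  ∑ y ∈ G.neighborFinset x, (f y - f x)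

/-- Bakry–Émery Γ operator. -/
noncomputable def gam {V : Type*} (G : SimpleGraph V) [G.LocallyFinite] (f g : V → ℝ) (x : V) : ℝ :=
  (lap G (fun v => f v * g v) x - f x * lap G g x - g x * lap G f x) / 2

/-- Bakry–Émery Γ₂ operator. -/
noncomputable def gam2 {V : Type*} (G : SimpleGraph V) [G.LocallyFinite] (f g : V → ℝ) (x : V) : ℝ :=
  (lap G (gam G f g) x - gam G f (lap G g) x - gam G (lap G f) g x) / 2

/-- The coefficient 1/N for N ∈ (0,∞], with 1/∞ = 0. -/
noncomputable def invN (N : ℝ≥0∞) : ℝ := (N⁻¹).toReal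

/-- The vertex `x` satisfies the curvature-dimension inequality CD(K,N). -/
def CD {V : Type*} (G : SimpleGraph V) [G.LocallyFinite] (K : ℝ) (N : ℝ≥0∞) (x : V) : Prop :=
  ∀ f : V → ℝ, gam2 G f f x ≥ invN N * (lap G f x) ^ 2 + K * gam G f f x

lemma gam_eq {V : Type*} (G : SimpleGraph V) [G.LocallyFinite] (f g : V → ℝ) (x : V) :
    gam G f g x = (∑ y ∈ G.neighborFinset x, (f y - f x) * (g y - g x)) / 2 := by
  unfold gam lap
  rw [Finset.mul_sum, Finset.mul_sum, ← Finset.sum_sub_distrib, ← Finset.sum_sub_distrib]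
  congr 1
  apply Finset.sum_congr rfl
  intro y _
  ring

lemma gam2_eq {V : Type*} (G : SimpleGraph V) [G.LocallyFinite]
    (d : ℕ) (hreg : ∀ v : V, G.degree v = d) (f : V → ℝ) (x : V) :
    4 * gam2 G f f x =
      ∑ y ∈ G.neighborFinset x, (∑ z ∈ G.neighborFinset y, ((f z - f y) - (f y - f x)) ^ 2)
      - 2 * d * (∑ y ∈ G.neighborFinset x, (f y - f x) ^ 2) + 2 * (lap G f x) ^ 2 := by
  have hcard : ∀ v, ((G.neighborFinset v).card : ℝ) = d := by
    intro v
    rw [G.card_neighborFinset_eq_degree, hreg]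
  have e1 : gam G f (lap G f) x =
      (∑ y ∈ G.neighborFinset x, (f y - f x) * lap G f y - (lap G f x) ^ 2) / 2 := by
    rw [gam_eq]
    have : (lap G f x) ^ 2 = ∑ y ∈ G.neighborFinset x, (f y - f x) * lap G f x := by
      rw [← Finset.sum_mul, sq]; rfl
    rw [this, ← Finset.sum_sub_distrib]
    congr 1
    apply Finset.sum_congr rfl
    intro y _
    ring
  have e1' : gam G (lap G f) f x = gam G f (lap G f) x := by
    rw [gam_eq, gam_eq]
    congr 1
    apply Finset.sum_congr rfl
    intro y _
    ring
  have e2 : lap G (gam G f f) x = ∑ y ∈ G.neighborFinset x, gam G f f y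
      - d * gam G f f x := by
    rw [lap, Finset.sum_sub_distrib, Finset.sum_const, nsmul_eq_mul, hcard]
  have e3 : ∀ y, ∑ z ∈ G.neighborFinset y, ((f z - f y) - (f y - f x)) ^ 2 =
      2 * gam G f f y - 2 * ((f y - f x) * lap G f y) + d * (f y - f x) ^ 2 := by
    intro y
    rw [gam_eq, lap, ← hcard y, ← nsmul_eq_mul, ← Finset.sum_const, Finset.mul_sum,
      Finset.mul_sum, mul_div_cancel₀ _ (two_ne_zero), ← Finset.sum_sub_distrib,
      ← Finset.sum_add_distrib]
    apply Finset.sum_congr rfl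
    intro z _
    ring
  have e4 : gam G f f x = (∑ y ∈ G.neighborFinset x, (f y - f x) ^ 2) / 2 := by
    rw [gam_eq]
    simp only [sq]
  rw [gam2, e1', e1, e2, e4]
  simp only [e3, Finset.sum_add_distrib, Finset.sum_sub_distrib, ← Finset.mul_sum]
  ring

lemma gam2_ge {V : Type*} (G : SimpleGraph V) [G.LocallyFinite]
    (d : ℕ) (hreg : ∀ v : V, G.degree v = d) (f : V → ℝ) (x : V) :
    4 * gam2 G f f x ≥
      (4 - 2 * d) * (∑ y ∈ G.neighborFinset x, (f y - f x) ^ 2) + 2 * (lap G f x) ^ 2 := by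
  rw [gam2_eq G d hreg]
  have : ∑ y ∈ G.neighborFinset x, 4 * (f y - f x) ^ 2 ≤
      ∑ y ∈ G.neighborFinset x, (∑ z ∈ G.neighborFinset y, ((f z - f y) - (f y - f x)) ^ 2) := by
    apply Finset.sum_le_sum
    intro y hy
    have hx : x ∈ G.neighborFinset y := by
      rw [mem_neighborFinset] at hy ⊢; exact hy.symm
    have := Finset.single_le_sum (f := fun z => ((f z - f y) - (f y - f x)) ^ 2)
      (fun z _ => sq_nonneg _) hx
    refine le_trans (le_of_eq ?_) this
    ring
  rw [← Finset.mul_sum] at this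
  linarith

lemma exists_test {V : Type*} (G : SimpleGraph V) [G.LocallyFinite]
    (d : ℕ) (hT : G.IsTree) (hreg : ∀ v : V, G.degree v = d) (x : V) (a : V → ℝ) :
    ∃ f : V → ℝ, (∀ y ∈ G.neighborFinset x, f y - f x = a y) ∧
      4 * gam2 G f f x =
      (4 - 2 * d) * (∑ y ∈ G.neighborFinset x, (a y) ^ 2)
        + 2 * (∑ y ∈ G.neighborFinset x, a y) ^ 2 := by
  classical
  have tri : ∀ y z, G.Adj x y → G.Adj y z → G.Adj x z → False := by
    intro y z h1 h2 h3
    have hp := hT.IsAcyclic.path_unique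
      (⟨Walk.cons h1 (Walk.cons h2 Walk.nil), by simp [h1.ne, h2.ne, h3.ne]⟩ : G.Path x z)
      (⟨Walk.cons h3 Walk.nil, by simp [h3.ne]⟩ : G.Path x z)
    have := congrArg (fun p : G.Path x z => p.1.length) hp
    simp at this
  have quad : ∀ y y' z, G.Adj x y → G.Adj y z → G.Adj x y' → G.Adj y' z → x ≠ z → y = y' := by
    intro y y' z h1 h2 h3 h4 hxz
    have hp := hT.IsAcyclic.path_unique
      (⟨Walk.cons h1 (Walk.cons h2 Walk.nil), by simp [h1.ne, h2.ne, hxz]⟩ : G.Path x z)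
      (⟨Walk.cons h3 (Walk.cons h4 Walk.nil), by simp [h3.ne, h4.ne, hxz]⟩ : G.Path x z)
    have := congrArg (fun p : G.Path x z => p.1.snd) hp
    simpa using this
  let f : V → ℝ := fun v => if v = x then 0 else if G.Adj x v then a v else
    if h : ∃ y, G.Adj x y ∧ G.Adj y v then 2 * a h.choose else 0
  have fx : f x = 0 := by simp [f]
  have fy : ∀ y, G.Adj x y → f y = a y := by
    intro y hy
    simp [f, hy, hy.ne']
  have fz : ∀ y z, G.Adj x y → G.Adj y z → z ≠ x → f z = 2 * a y := by
    intro y z h1 h2 hz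
    have h : ∃ y, G.Adj x y ∧ G.Adj y z := ⟨y, h1, h2⟩
    have h3 : ¬ G.Adj x z := fun h3 => tri y z h1 h2 h3
    have : f z = 2 * a h.choose := by
      simp only [f, if_neg hz, if_neg h3, dif_pos h]
    rw [this, quad h.choose y z h.choose_spec.1 h.choose_spec.2 h1 h2 hz.symm]
  have key : ∀ y ∈ G.neighborFinset x, f y - f x = a y := by
    intro y hy
    rw [mem_neighborFinset] at hy
    rw [fx, fy y hy, sub_zero]
  refine ⟨f, key, ?_⟩
  rw [gam2_eq G d hreg, lap, Finset.sum_congr rfl key]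
  have h1 : ∑ y ∈ G.neighborFinset x, (f y - f x) ^ 2 = ∑ y ∈ G.neighborFinset x, (a y) ^ 2 :=
    Finset.sum_congr rfl fun y hy => by rw [key y hy]
  have h2 : ∑ y ∈ G.neighborFinset x,
      (∑ z ∈ G.neighborFinset y, ((f z - f y) - (f y - f x)) ^ 2) =
      ∑ y ∈ G.neighborFinset x, 4 * (a y) ^ 2 := by
    apply Finset.sum_congr rfl
    intro y hy
    rw [mem_neighborFinset] at hy
    rw [Finset.sum_eq_single x]
    · rw [fx, fy y hy]; ring
    · intro z hz hzx
      rw [mem_neighborFinset] at hz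
      rw [fz y z hy hz hzx, fx, fy y hy]; ring
    · intro h
      exact absurd ((G.mem_neighborFinset y x).2 hy.symm) h
  rw [h1, h2, ← Finset.mul_sum]
  ring

lemma cd_test {V : Type*} (G : SimpleGraph V) [G.LocallyFinite]
    (d : ℕ) (hT : G.IsTree) (hreg : ∀ v : V, G.degree v = d) (x : V) (a : V → ℝ)
    (K : ℝ) (N : ℝ≥0∞) (h : CD G K N x) :
    (4 - 2 * d) * (∑ y ∈ G.neighborFinset x, (a y) ^ 2)
        + 2 * (∑ y ∈ G.neighborFinset x, a y) ^ 2 ≥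
      4 * invN N * (∑ y ∈ G.neighborFinset x, a y) ^ 2
        + 2 * K * (∑ y ∈ G.neighborFinset x, (a y) ^ 2) := by
  obtain ⟨f, hf, h2⟩ := exists_test G d hT hreg x a
  have := h f
  have h3 : gam G f f x = (∑ y ∈ G.neighborFinset x, (a y) ^ 2) / 2 := by
    rw [gam_eq]
    congr 1
    exact Finset.sum_congr rfl fun y hy => by rw [hf y hy, sq]
  rw [lap, Finset.sum_congr rfl hf, h3] at this
  linarith

theorem stmt_11 {V : Type*} (G : SimpleGraph V) [G.LocallyFinite]
    (d : ℕ) (hd : 2 ≤ d) (hT : G.IsTree) (hreg : ∀ v : V, G.degree v = d) (x : V)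
    (KF : ℝ≥0∞ → ℝ) (hKF : ∀ N : ℝ≥0∞, 0 < N → IsGreatest {K : ℝ | CD G K N x} (KF N)) :
    (∀ N : ℝ≥0∞, 0 < N → N ≤ 2 → KF N = 2 - 2 * (d : ℝ) * invN N) ∧
    (∀ N : ℝ≥0∞, 2 < N → KF N = 2 - (d : ℝ)) := by
  have hcard : ((G.neighborFinset x).card : ℝ) = d := by
    rw [G.card_neighborFinset_eq_degree, hreg]
  have hd' : (2 : ℝ) ≤ d := by exact_mod_cast hd
  have hgam : ∀ f : V → ℝ, gam G f f x = (∑ y ∈ G.neighborFinset x, (f y - f x) ^ 2) / 2 := by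
    intro f
    rw [gam_eq]
    simp only [sq]
  constructor
  · intro N hN hN2
    have hinv : 1 / 2 ≤ invN N := by
      have h1 : (2 : ℝ≥0∞)⁻¹ ≤ N⁻¹ := ENNReal.inv_le_inv.2 hN2
      have h2 := ENNReal.toReal_mono (ENNReal.inv_ne_top.2 hN.ne') h1
      simpa [invN] using h2
    apply le_antisymm
    · have := cd_test G d hT hreg x (fun _ => 1) _ N (hKF N hN).1
      simp only [one_pow, Finset.sum_const, nsmul_eq_mul, hcard, mul_one] at this
      have h : (d : ℝ) * KF N ≤ d * (2 - 2 * d * invN N) := by nlinarith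
      exact le_of_mul_le_mul_left h (by linarith)
    · apply (hKF N hN).2
      intro f
      have h1 := gam2_ge G d hreg f x
      have h2 : (lap G f x) ^ 2 ≤ d * (∑ y ∈ G.neighborFinset x, (f y - f x) ^ 2) := by
        rw [← hcard]
        exact sq_sum_le_card_mul_sum_sq
      rw [hgam]
      nlinarith [mul_le_mul_of_nonneg_left h2 (sub_nonneg.2 hinv)]
  · intro N hN2
    have hN : 0 < N := lt_trans (by norm_num) hN2
    have hinv : invN N ≤ 1 / 2 := by
      have h1 : N⁻¹ ≤ (2 : ℝ≥0∞)⁻¹ := ENNReal.inv_le_inv.2 hN2.le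
      have h2 := ENNReal.toReal_mono (by simp) h1
      simpa [invN] using h2
    apply le_antisymm
    · classical
      have hc : 1 < (G.neighborFinset x).card := by
        rw [G.card_neighborFinset_eq_degree, hreg]; omega
      obtain ⟨u, hu, v, hv, huv⟩ := Finset.one_lt_card.1 hc
      have := cd_test G d hT hreg x
        (fun y => (if y = u then 1 else 0) - (if y = v then 1 else 0)) _ N (hKF N hN).1
      have hs : ∑ y ∈ G.neighborFinset x,
          ((if y = u then (1 : ℝ) else 0) - (if y = v then 1 else 0)) = 0 := by
        rw [Finset.sum_sub_distrib, Finset.sum_ite_eq', Finset.sum_ite_eq', if_pos hu, if_pos hv,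
          sub_self]
      have hpos : 0 < ∑ y ∈ G.neighborFinset x,
          ((if y = u then (1 : ℝ) else 0) - (if y = v then 1 else 0)) ^ 2 := by
        apply Finset.sum_pos' (fun _ _ => sq_nonneg _)
        exact ⟨u, hu, by simp [huv]⟩
      rw [hs] at this
      refine le_of_mul_le_mul_left ?_ hpos
      linarith
    · apply (hKF N hN).2
      intro f
      have h1 := gam2_ge G d hreg f x
      rw [hgam]
      nlinarith [mul_nonneg (sub_nonneg.2 hinv) (sq_nonneg (lap G f x))]
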